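/- Exactness for risk-independent policies: if a risk-dependent policy π̃ satisfies π̃(s,y) = π(s) for some Markovian policy π : S → A (i.e., the action does not depend on the risk level), then for every α ∈ (0,1], V^{π̃}(s₀, α) = CVaR_α[Z^{π}], where π is viewed as the history-dependent policy selecting π(S_t) at every step; in particular the CVaR evaluation gap of π̃ is zero at every initial risk level. -/

import Mathlib

open Finset

section CVaRDefs

attribute [local instance] Classical.propDecidable

variable {S A : Type*}

/-- Risk envelope `U_y(p)` for a pmf `p` on a finite type `Ω`. -/
def RiskEnv {Ω : Type*} [Fintype Ω] (y : ℝ) (p : Ω → ℝ) (ξ : Ω → ℝ) : Prop :=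
  (∀ ω, 0 ≤ ξ ω ∧ ξ ω ≤ 1 / y) ∧ ∑ ω, p ω * ξ ω = 1

/-- State at time `k` along a history `H` starting from `s`
    (a history records, at each step, the action taken and the next state). -/
def stAt (s : S) {t : ℕ} (H : Fin t → A × S) : ℕ → S
  | 0 => s
  | k + 1 => if h : k < t then (H ⟨k, h⟩).2 else s

/-- Length-`k` prefix of a history (junk values beyond `t`). -/
noncomputable def pre [Nonempty S] [Nonempty A] {t : ℕ} (H : Fin t → A × S) (k : ℕ) :
    Fin k → A × S :=
  fun i => if h : (i : ℕ) < t then H ⟨i, h⟩ else Classical.arbitrary _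

/-- Deterministic history-dependent policies. -/
abbrev HPolicy (S A : Type*) := ∀ k : ℕ, (Fin k → A × S) → A

/-- Probability of history `H` under transition kernel `P` and policy `πh`, starting from `s`. -/
noncomputable def histProb [Nonempty S] [Nonempty A] (P : S → A → S → ℝ) (s : S)
    (πh : HPolicy S A) {t : ℕ} (H : Fin t → A × S) : ℝ :=
  ∏ k : Fin t,
    P (stAt s H k) (H k).1 (H k).2 * (if (H k).1 = πh k (pre H k) then 1 else 0)

/-- Discounted return of history `H` starting from `s`. -/
def ret (R : S → A → S → ℝ) (γ : ℝ) (s : S) {t : ℕ} (H : Fin t → A × S) : ℝ :=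
  ∑ k : Fin t, γ ^ (k : ℕ) * R (stAt s H k) (H k).1 (H k).2

/-- Static CVaR of a history-dependent policy at level `α` (dual formulation). -/
noncomputable def staticCVaR [Fintype S] [Fintype A] [Nonempty S] [Nonempty A]
    (P R : S → A → S → ℝ) (γ : ℝ) (s : S) (T : ℕ) (πh : HPolicy S A) (α : ℝ) : ℝ :=
  sInf {x | ∃ ξ : (Fin T → A × S) → ℝ,
    RiskEnv α (fun H => histProb P s πh H) ξ ∧
    x = ∑ H : Fin T → A × S, histProb P s πh H * ξ H * ret R γ s H}

/-- A valid state-level perturbation family (with the convention `ξ̃(·|s,0,a) ≡ 1`). -/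
def ValidFamily [Fintype S] (P : S → A → S → ℝ) (ξt : S → ℝ → A → S → ℝ) : Prop :=
  (∀ s y a, 0 < y → y ≤ 1 → RiskEnv y (P s a) (ξt s y a)) ∧
  ∀ s a s', ξt s 0 a s' = 1

/-- Policy–perturbation value function `V^{π̃,ξ̃}_t`. -/
def Vxi [Fintype S] (P R : S → A → S → ℝ) (γ : ℝ) (πt : S → ℝ → A)
    (ξt : S → ℝ → A → S → ℝ) : ℕ → S → ℝ → ℝ
  | 0, _, _ => 0
  | t + 1, s, y =>
    ∑ s' : S, P s (πt s y) s' * ξt s y (πt s y) s' *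
      (R s (πt s y) s' + γ * Vxi P R γ πt ξt t s' (y * ξt s y (πt s y) s'))

/-- Risk-dependent value function `V^{π̃}_t` (dynamic-programming CVaR evaluation). -/
noncomputable def Vdp [Fintype S] (P R : S → A → S → ℝ) (γ : ℝ) (πt : S → ℝ → A) :
    ℕ → S → ℝ → ℝ
  | 0, _, _ => 0
  | t + 1, s, y =>
    sInf {x | ∃ ξ : S → ℝ, RiskEnv y (P s (πt s y)) ξ ∧
      x = ∑ s' : S, P s (πt s y) s' * ξ s' *
        (R s (πt s y) s' + γ * Vdp P R γ πt t s' (y * ξ s'))}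

/-- Risk level `Y_k` at time `k` along history `H`, starting from `Y₀ = α`. -/
def riskAt (ξt : S → ℝ → A → S → ℝ) (s : S) (α : ℝ) {t : ℕ} (H : Fin t → A × S) :
    ℕ → ℝ
  | 0 => α
  | k + 1 =>
    riskAt ξt s α H k *
      if h : k < t then ξt (stAt s H k) (riskAt ξt s α H k) (H ⟨k, h⟩).1 (H ⟨k, h⟩).2 else 1

/-- Mapped history perturbation `ζ_α^{ξ̃}`. -/
def zeta (ξt : S → ℝ → A → S → ℝ) (s : S) (α : ℝ) {t : ℕ} (H : Fin t → A × S) : ℝ :=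
  ∏ k : Fin t, ξt (stAt s H k) (riskAt ξt s α H k) (H k).1 (H k).2

/-- History-dependent policy induced by `(π̃, ξ̃, α)` from initial state `s`. -/
def inducedPolicy (πt : S → ℝ → A) (ξt : S → ℝ → A → S → ℝ) (s : S) (α : ℝ) :
    HPolicy S A :=
  fun k H => πt (stAt s H k) (riskAt ξt s α H k)

/-- `ξ̃` attains the minima in the risk-dependent value recursion (at every augmented state). -/
def AttainsMin [Fintype S] (P R : S → A → S → ℝ) (γ : ℝ) (πt : S → ℝ → A)
    (ξt : S → ℝ → A → S → ℝ) : Prop :=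
  ∀ t : ℕ, ∀ s : S, ∀ y : ℝ, 0 < y → y ≤ 1 →
    Vdp P R γ πt (t + 1) s y =
      ∑ s' : S, P s (πt s y) s' * ξt s y (πt s y) s' *
        (R s (πt s y) s' + γ * Vdp P R γ πt t s' (y * ξt s y (πt s y) s'))

/-- Risk-propagation and state-level-envelope constraints of a risk-level assignment `Y`
    with respect to policy `πh`, initial level `α`, and history perturbation `ξ`. -/
def StructConsistent [Fintype S] [Fintype A] [Nonempty S] [Nonempty A]
    (P : S → A → S → ℝ) (s0 : S) (T : ℕ) (πh : HPolicy S A) (α : ℝ)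
    (ξ : (Fin T → A × S) → ℝ) (Y : ∀ k : ℕ, (Fin k → A × S) → ℝ) : Prop :=
  ∀ H : Fin T → A × S, 0 < histProb P s0 πh H →
    (Y 0 (pre H 0) = α ∧ Y T H = α * ξ H) ∧
    ∀ t : ℕ, ∀ ht : t < T,
      ∑ s' : S, P (stAt s0 H t) (H ⟨t, ht⟩).1 s' *
        (Y (t + 1) (Fin.snoc (pre H t) ((H ⟨t, ht⟩).1, s')) / Y t (pre H t)) = 1

/-- Action-selection consistency constraints of a risk-level assignment `Y` with respect to the
    risk-dependent policy `πt` along positive-probability histories of `πh`. -/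
def ActionConsistent [Fintype S] [Fintype A] [Nonempty S] [Nonempty A]
    (P : S → A → S → ℝ) (s0 : S) (T : ℕ) (πh : HPolicy S A)
    (πt : S → ℝ → A) (Y : ∀ k : ℕ, (Fin k → A × S) → ℝ) : Prop :=
  ∀ H : Fin T → A × S, 0 < histProb P s0 πh H →
    ∀ t : ℕ, ∀ ht : t < T, πt (stAt s0 H t) (Y t (pre H t)) = (H ⟨t, ht⟩).1

end CVaRDefs

section Helpers

variable {S A : Type*}

lemma stAt_cons (s : S) {t : ℕ} (x : A × S) (H : Fin t → A × S) (k : ℕ) (hk : k ≤ t) :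
    stAt s (Fin.cons x H : Fin (t + 1) → A × S) (k + 1) = stAt x.2 H k := by
  cases k with
  | zero => simp [stAt]
  | succ k =>
    have h1 : k < t := hk
    have h2 : (⟨k + 1, by omega⟩ : Fin (t + 1)) = Fin.succ ⟨k, h1⟩ := rfl
    simp only [stAt]
    rw [dif_pos (by omega), dif_pos h1, h2, Fin.cons_succ]

lemma stAt_pre [Nonempty S] [Nonempty A] (s : S) {t : ℕ} (H : Fin t → A × S) (k : ℕ)
    (hk : k ≤ t) : stAt s (pre H k) k = stAt s H k := by
  cases k with
  | zero => simp [stAt]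
  | succ k =>
    have h1 : k < t := hk
    simp [stAt, pre, h1]

/-- The Markov policy as a history-dependent policy. -/
abbrev mpol (π : S → A) (s : S) : HPolicy S A := fun k (H : Fin k → A × S) => π (stAt s H k)

lemma histProb_cons [Nonempty S] [Nonempty A] (P : S → A → S → ℝ) (π : S → A) (s : S) {t : ℕ}
    (x : A × S) (H : Fin t → A × S) [Decidable (x.1 = π s)] :
    histProb P s (mpol π s) (Fin.cons x H : Fin (t + 1) → A × S) =
      P s x.1 x.2 * (if x.1 = π s then 1 else 0) * histProb P x.2 (mpol π x.2) H := by
  unfold histProb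
  rw [Fin.prod_univ_succ]
  congr 1
  · simp only [Fin.cons_zero, Fin.val_zero, stAt, mpol]
  · apply Finset.prod_congr rfl
    intro k _
    have e1 := stAt_cons s x H k (by omega)
    have e2 := stAt_pre s (Fin.cons x H : Fin (t + 1) → A × S) (k + 1) (by omega)
    have e3 := stAt_pre x.2 H k (by omega)
    classical
    refine congrArg₂ (· * ·) ?_ (if_congr ?_ rfl rfl)
    · simp only [Fin.cons_succ, Fin.val_succ, e1]
    · simp only [Fin.cons_succ, Fin.val_succ, mpol, e1, e2, e3]

lemma ret_cons (R : S → A → S → ℝ) (γ : ℝ) (s : S) {t : ℕ} (x : A × S) (H : Fin t → A × S) :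
    ret R γ s (Fin.cons x H : Fin (t + 1) → A × S) = R s x.1 x.2 + γ * ret R γ x.2 H := by
  unfold ret
  rw [Fin.sum_univ_succ, Finset.mul_sum]
  congr 1
  · simp [stAt]
  · apply Finset.sum_congr rfl
    intro k _
    simp only [Fin.cons_succ, Fin.val_succ]
    rw [stAt_cons _ _ _ _ (by omega)]
    ring

lemma sum_hist [Fintype S] [Fintype A] [Nonempty S] [Nonempty A] (P : S → A → S → ℝ)
    (π : S → A) (s : S) (t : ℕ) (g : (Fin (t + 1) → A × S) → ℝ) :
    ∑ H, histProb P s (mpol π s) H * g H =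
      ∑ s', P s (π s) s' * ∑ H : Fin t → A × S,
        histProb P s' (mpol π s') H * g (Fin.cons (π s, s') H) := by
  classical
  rw [← (Fin.consEquiv (fun _ : Fin (t + 1) => A × S)).sum_comp, Fintype.sum_prod_type,
    Fintype.sum_prod_type, Finset.sum_eq_single (π s)]
  · apply Finset.sum_congr rfl
    intro s' _
    rw [Finset.mul_sum]
    apply Finset.sum_congr rfl
    intro H _
    change histProb P s (mpol π s) (Fin.cons (π s, s') H : Fin (t + 1) → A × S) *
      g (Fin.cons (π s, s') H) = _
    rw [histProb_cons]
    simp only [if_true]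
    ring
  · intro a _ ha
    apply Finset.sum_eq_zero
    intro s' _
    apply Finset.sum_eq_zero
    intro H _
    change histProb P s (mpol π s) (Fin.cons (a, s') H : Fin (t + 1) → A × S) *
      g (Fin.cons (a, s') H) = _
    rw [histProb_cons]
    simp [ha]
  · simp

lemma histProb_nonneg [Nonempty S] [Nonempty A] (P : S → A → S → ℝ)
    (hP : ∀ s a s', 0 ≤ P s a s') (s : S) (p : HPolicy S A) {t : ℕ} (H : Fin t → A × S) :
    0 ≤ histProb P s p H := by
  unfold histProb
  apply Finset.prod_nonneg
  intro k _
  apply mul_nonneg (hP _ _ _)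
  split_ifs <;> norm_num

lemma histProb_sum [Fintype S] [Fintype A] [Nonempty S] [Nonempty A] (P : S → A → S → ℝ)
    (hP : ∀ s a, ∑ s', P s a s' = 1) (π : S → A) (t : ℕ) :
    ∀ s, ∑ H : Fin t → A × S, histProb P s (mpol π s) H = 1 := by
  induction t with
  | zero => intro s; simp [histProb]
  | succ t ih =>
    intro s
    have := sum_hist P π s t (fun _ => 1)
    simp only [mul_one, ih, hP] at this
    exact this

/-- The set over which the CVaR infimum is taken. -/
def cset {Ω : Type*} [Fintype Ω] (p f : Ω → ℝ) (y : ℝ) : Set ℝ :=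
  {x | ∃ ξ : Ω → ℝ, RiskEnv y p ξ ∧ x = ∑ ω, p ω * ξ ω * f ω}

lemma cset_bdd {Ω : Type*} [Fintype Ω] (p f : Ω → ℝ) (y : ℝ) (hp : ∀ ω, 0 ≤ p ω) :
    BddBelow (cset p f y) := by
  refine ⟨-∑ ω, p ω * (1 / y) * |f ω|, ?_⟩
  rintro x ⟨ξ, ⟨h, -⟩, rfl⟩
  rw [← Finset.sum_neg_distrib]
  apply Finset.sum_le_sum
  intro ω _
  have h1 : p ω * ξ ω * |f ω| ≤ p ω * (1 / y) * |f ω| :=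
    mul_le_mul_of_nonneg_right (mul_le_mul_of_nonneg_left (h ω).2 (hp ω)) (abs_nonneg _)
  have h2 : p ω * ξ ω * (-|f ω|) ≤ p ω * ξ ω * f ω :=
    mul_le_mul_of_nonneg_left (neg_abs_le _) (mul_nonneg (hp ω) (h ω).1)
  linarith

lemma cset_nonempty {Ω : Type*} [Fintype Ω] (p f : Ω → ℝ) (y : ℝ) (hp : ∑ ω, p ω = 1)
    (hy : 0 < y) (hy1 : y ≤ 1) : (cset p f y).Nonempty := by
  refine ⟨_, fun _ => 1, ⟨fun ω => ⟨zero_le_one, ?_⟩, by simpa using hp⟩, rfl⟩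
  rw [le_div_iff₀ hy]; linarith

/-- The static CVaR of a Markov policy. -/
noncomputable abbrev C [Fintype S] [Fintype A] [Nonempty S] [Nonempty A]
    (P R : S → A → S → ℝ) (γ : ℝ) (π : S → A) (t : ℕ) (s : S) (y : ℝ) : ℝ :=
  sInf (cset (fun H : Fin t → A × S => histProb P s (mpol π s) H) (fun H => ret R γ s H) y)

lemma sInf_le_aux {X : Type*} (Q : X → Prop) (v : X → ℝ) (c : ℝ) (h : ∀ ξ, Q ξ → c ≤ v ξ)
    (ξ : X) (hξ : Q ξ) : sInf {x | ∃ ξ, Q ξ ∧ x = v ξ} ≤ v ξ := by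
  apply csInf_le
  · refine ⟨c, ?_⟩
    rintro x ⟨ξ, h', rfl⟩
    exact h ξ h'
  · exact ⟨ξ, hξ, rfl⟩

lemma key [Fintype S] [Fintype A] [Nonempty S] [Nonempty A]
    (P R : S → A → S → ℝ) (γ : ℝ) (hγ0 : 0 < γ)
    (hP : ∀ s a, (∀ s', 0 ≤ P s a s') ∧ ∑ s', P s a s' = 1) (π : S → A) (πt : S → ℝ → A)
    (hπt : ∀ s y, πt s y = π s) (t : ℕ) :
    ∀ s y, 0 < y → y ≤ 1 → Vdp P R γ πt t s y = C P R γ π t s y := by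
  have hpn : ∀ (t : ℕ) (s : S) (H : Fin t → A × S), 0 ≤ histProb P s (mpol π s) H :=
    fun t s H => histProb_nonneg P (fun s a => (hP s a).1) s _ H
  have hps := histProb_sum P (fun s a => (hP s a).2) π
  induction t with
  | zero =>
    intro s y hy hy1
    have hx : cset (fun H : Fin 0 → A × S => histProb P s (mpol π s) H)
        (fun H => ret R γ s H) y = {0} := by
      obtain ⟨x, hx⟩ := cset_nonempty (fun H : Fin 0 → A × S => histProb P s (mpol π s) H)
        (fun H => ret R γ s H) y (hps 0 s) hy hy1
      refine Set.eq_singleton_iff_nonempty_unique_mem.2 ⟨⟨x, hx⟩, ?_⟩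
      rintro z ⟨ξ, -, rfl⟩
      simp [ret]
    simp only [C, hx, csInf_singleton, Vdp]
  | succ t ih =>
    intro s y hy hy1
    have hV : ∀ (ξ : S → ℝ), RiskEnv y (P s (π s)) ξ →
        ∀ s', ξ s' * Vdp P R γ πt t s' (y * ξ s') = ξ s' * C P R γ π t s' (y * ξ s') := by
      intro ξ hξ s'
      rcases (hξ.1 s').1.eq_or_lt with h | h
      · simp [← h]
      · rw [ih s' _ (mul_pos hy h)]
        have := (hξ.1 s').2
        rw [le_div_iff₀ hy] at this
        linarith
    have hdp : Vdp P R γ πt (t + 1) s y = sInf {x | ∃ ξ : S → ℝ, RiskEnv y (P s (π s)) ξ ∧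
        x = ∑ s' : S, P s (π s) s' * (ξ s' * R s (π s) s'
          + γ * (ξ s' * C P R γ π t s' (y * ξ s')))} := by
      simp only [Vdp, hπt]
      congr 1
      ext x
      apply exists_congr
      intro ξ
      apply and_congr_right
      intro hξ
      have : ∀ s', P s (π s) s' * (ξ s' * R s (π s) s'
          + γ * (ξ s' * C P R γ π t s' (y * ξ s'))) = P s (π s) s' * ξ s' *
        (R s (π s) s' + γ * Vdp P R γ πt t s' (y * ξ s')) := by
        intro s'
        rw [← hV ξ hξ s']; ring
      simp only [this]
    rw [hdp]
    -- from a state-level perturbation to an almost optimal history perturbation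
    have hlow : ∀ ξ : S → ℝ, RiskEnv y (P s (π s)) ξ → C P R γ π (t + 1) s y ≤
        ∑ s' : S, P s (π s) s' * (ξ s' * R s (π s) s'
          + γ * (ξ s' * C P R γ π t s' (y * ξ s'))) := by
      intro ξ hξ
      apply le_of_forall_pos_le_add
      intro ε hε
      have hε' : 0 < ε / γ := div_pos hε hγ0
      have hex : ∀ s', ∃ η : (Fin t → A × S) → ℝ, (∀ H, 0 ≤ η H ∧ η H ≤ 1 / y) ∧
          ∑ H, histProb P s' (mpol π s') H * η H = ξ s' ∧
          ∑ H, histProb P s' (mpol π s') H * η H * ret R γ s' H ≤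
            ξ s' * (C P R γ π t s' (y * ξ s') + ε / γ) := by
        intro s'
        rcases (hξ.1 s').1.eq_or_lt with h | h
        · refine ⟨fun _ => 0, fun H => ⟨le_rfl, by positivity⟩, ?_, ?_⟩ <;> simp [← h]
        · have h2 := (hξ.1 s').2
          rw [le_div_iff₀ hy] at h2
          obtain ⟨x, ⟨η, hη, rfl⟩, hx⟩ := exists_lt_of_csInf_lt
            (cset_nonempty (fun H : Fin t → A × S => histProb P s' (mpol π s') H)
              (fun H => ret R γ s' H) (y * ξ s') (hps t s') (mul_pos hy h) (by linarith))
            (lt_add_of_pos_right _ hε')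
          refine ⟨fun H => ξ s' * η H, fun H => ⟨mul_nonneg h.le (hη.1 H).1, ?_⟩, ?_, ?_⟩
          · have h3 := mul_le_mul_of_nonneg_left (hη.1 H).2 h.le
            refine h3.trans (le_of_eq ?_)
            field_simp
          · have h3 := hη.2
            calc _ = ξ s' * ∑ H, histProb P s' (mpol π s') H * η H := by
                  rw [Finset.mul_sum]; exact Finset.sum_congr rfl fun H _ => by ring
              _ = _ := by rw [h3, mul_one]
          · refine le_trans (le_of_eq ?_) (mul_le_mul_of_nonneg_left hx.le h.le)
            rw [Finset.mul_sum]; exact Finset.sum_congr rfl fun H _ => by ring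
      choose η hη1 hη2 hη3 using hex
      refine (csInf_le (cset_bdd _ _ _ (hpn _ s)) ⟨fun H => η (H 0).2 (Fin.tail H),
        ⟨fun H => hη1 _ _, ?_⟩, rfl⟩).trans ?_
      · rw [sum_hist]
        simp only [Fin.cons_zero, Fin.tail_cons, hη2]
        exact hξ.2
      · simp only [mul_assoc]
        rw [sum_hist]
        simp only [Fin.cons_zero, Fin.tail_cons, ret_cons]
        have hε2 : ε = ∑ s', P s (π s) s' * (ξ s' * ε) := by
          simp only [← mul_assoc]
          rw [← Finset.sum_mul, hξ.2, one_mul]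
        conv_rhs => rw [hε2]
        rw [← Finset.sum_add_distrib]
        apply Finset.sum_le_sum
        intro s' _
        rw [← mul_add]
        apply mul_le_mul_of_nonneg_left _ ((hP s (π s)).1 s')
        have e : ∑ H, histProb P s' (mpol π s') H * (η s' H * (R s (π s) s' + γ * ret R γ s' H))
            = ξ s' * R s (π s) s' +
              γ * ∑ H, histProb P s' (mpol π s') H * η s' H * ret R γ s' H := by
          rw [← hη2 s', Finset.sum_mul, Finset.mul_sum, ← Finset.sum_add_distrib]
          exact Finset.sum_congr rfl fun H _ => by ring
        rw [e]
        have h4 := mul_le_mul_of_nonneg_left (hη3 s') hγ0.le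
        have h5 : γ * (ξ s' * (C P R γ π t s' (y * ξ s') + ε / γ)) =
            γ * (ξ s' * C P R γ π t s' (y * ξ s')) + ξ s' * ε := by
          field_simp
        linarith
    apply le_antisymm
    · apply le_csInf (cset_nonempty _ _ _ (hps _ s) hy hy1)
      rintro x ⟨η, hη, rfl⟩
      have hηs := hη.2
      rw [sum_hist] at hηs
      have hξ : RiskEnv y (P s (π s)) (fun s' => ∑ H : Fin t → A × S,
          histProb P s' (mpol π s') H * η (Fin.cons (π s, s') H)) := by
        refine ⟨fun s' => ⟨Finset.sum_nonneg fun H _ => mul_nonneg (hpn _ _ _) (hη.1 _).1, ?_⟩,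
          hηs⟩
        calc _ ≤ ∑ H : Fin t → A × S, histProb P s' (mpol π s') H * (1 / y) :=
              Finset.sum_le_sum fun H _ => mul_le_mul_of_nonneg_left (hη.1 _).2 (hpn _ _ _)
          _ = 1 / y := by rw [← Finset.sum_mul, hps, one_mul]
      refine le_trans (sInf_le_aux _ _ _ hlow _ hξ) ?_
      · simp only [mul_assoc]
        rw [sum_hist]
        simp only [ret_cons]
        apply Finset.sum_le_sum
        intro s' _
        apply mul_le_mul_of_nonneg_left _ ((hP s (π s)).1 s')
        have e : ∑ H, histProb P s' (mpol π s') H * (η (Fin.cons (π s, s') H) *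
              (R s (π s) s' + γ * ret R γ s' H))
            = (∑ H, histProb P s' (mpol π s') H * η (Fin.cons (π s, s') H)) * R s (π s) s' +
              γ * ∑ H, histProb P s' (mpol π s') H * η (Fin.cons (π s, s') H)
                * ret R γ s' H := by
          rw [Finset.sum_mul, Finset.mul_sum, ← Finset.sum_add_distrib]
          exact Finset.sum_congr rfl fun H _ => by ring
        rw [e]
        apply add_le_add le_rfl
        apply mul_le_mul_of_nonneg_left _ hγ0.le
        have hz0 := (hξ.1 s').1
        beta_reduce at hz0
        set z := ∑ H, histProb P s' (mpol π s') H * η (Fin.cons (π s, s') H) with hz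
        rcases hz0.eq_or_lt with h | h
        · have h0 : ∀ H, histProb P s' (mpol π s') H * η (Fin.cons (π s, s') H) = 0 := by
            have h1 := (Finset.sum_eq_zero_iff_of_nonneg (fun H _ =>
              mul_nonneg (hpn _ s' H) (hη.1 (Fin.cons (π s, s') H)).1)).1 (hz.symm.trans h.symm)
            exact fun H => h1 H (Finset.mem_univ _)
          simp [← h, h0]
        · have h1 : C P R γ π t s' (y * z) ≤ ∑ H, histProb P s' (mpol π s') H *
              (η (Fin.cons (π s, s') H) / z) * ret R γ s' H := by
            refine csInf_le (cset_bdd _ _ _ (hpn _ s')) ⟨_, ⟨fun H =>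
              ⟨div_nonneg (hη.1 (Fin.cons (π s, s') H)).1 h.le, ?_⟩, ?_⟩, rfl⟩
            · rw [div_mul_eq_div_div]
              exact div_le_div_of_nonneg_right (hη.1 _).2 h.le
            · simp only [← mul_div_assoc]
              rw [← Finset.sum_div, ← hz, div_self h.ne']
          refine (mul_le_mul_of_nonneg_left h1 h.le).trans (le_of_eq ?_)
          rw [Finset.mul_sum]
          refine Finset.sum_congr rfl fun H _ => ?_
          field_simp
    · apply le_csInf
      · refine ⟨_, fun _ => 1, ⟨fun ω => ⟨zero_le_one, ?_⟩, by simpa using (hP s (π s)).2⟩, rfl⟩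
        rw [le_div_iff₀ hy]; linarith
      · rintro x ⟨ξ, hξ, rfl⟩
        exact hlow ξ hξ

end Helpers

/-- exactness for risk-independent policies:
if a risk-dependent policy `π̃` satisfies `π̃(s,y) = π(s)` for some Markovian policy
`π : S → A` (the action does not depend on the risk level), then for every `α ∈ (0,1]`,
`V^{π̃}(s₀, α) = CVaR_α[Z^{π}]`, where `π` is viewed as the history-dependent policy
selecting `π(S_t)` at every step; in particular the CVaR evaluation gap of `π̃` is zero
at every initial risk level. -/
theorem stmt9 {S A : Type*} [Fintype S] [Fintype A] [Nonempty S] [Nonempty A]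
    (P R : S → A → S → ℝ) (γ : ℝ) (hγ0 : 0 < γ) (hγ1 : γ ≤ 1)
    (hP : ∀ s a, (∀ s', 0 ≤ P s a s') ∧ ∑ s', P s a s' = 1)
    (s0 : S) (T : ℕ) (π : S → A) (πt : S → ℝ → A)
    (hπt : ∀ s y, πt s y = π s)
    (α : ℝ) (hα0 : 0 < α) (hα1 : α ≤ 1) :
    Vdp P R γ πt T s0 α =
      staticCVaR P R γ s0 T (fun k (H : Fin k → A × S) => π (stAt s0 H k)) α := by
  exact key P R γ hγ0 hP π πt hπt T s0 α hα0 hα1
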